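/- arXiv:1603.05632 — 3 statements merged into one kernel-verified Lean document; each statement's English description precedes it below -/
import Mathlib

section
/- Assume W is a double-well potential (W ∈ C¹(ℝ), W(-1) = W(1) = 0, W(s) > 0 for s ≠ ±1). If u minimizes J₁ over X₁, then for almost every t ∈ ℝ one has |u'(t)| ≤ √(1 − 1/(1 + W(u(t)))²), and consequently ‖u'‖_{L^∞(ℝ)} ≤ √(1 − 1/(1 + max_{s ∈ [−1,1]} W(s))²) < 1. -/
open MeasureTheory Filter Topology Set
open scoped ENNReal

noncomputable section

/-- The class `X₁`: `W^{1,∞}(ℝ)` functions with `‖u'‖_{L^∞} ≤ 1` and `u(t) → ±1` as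
`t → ±∞`. -/
def memX1 (u : ℝ → ℝ) : Prop :=
  LipschitzWith 1 u ∧ Tendsto u atTop (𝓝 (1:ℝ)) ∧ Tendsto u atBot (𝓝 (-1:ℝ))

/-- `W` is a double-well potential: `C¹`, vanishing exactly at `±1` and positive elsewhere. -/
def DoubleWell (W : ℝ → ℝ) : Prop :=
  ContDiff ℝ 1 W ∧ W (-1) = 0 ∧ W 1 = 0 ∧ ∀ s : ℝ, s ≠ -1 → s ≠ 1 → 0 < W s

/-- The action functional `L_a(u) = ∫_ℝ (1 - √(1 - |u'|²) + a(t) W(u)) dt`. -/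
def LaE (a W u : ℝ → ℝ) : ℝ≥0∞ :=
  ∫⁻ t : ℝ, ENNReal.ofReal (1 - Real.sqrt (1 - (deriv u t) ^ 2) + a t * W (u t))

/-- `u` is a `C¹ ∩ W^{2,2}_loc` solution of `(u'/√(1-|u'|²))' = a(t) W'(u)` on `ℝ`,
expressed through the integrated form of the equation. -/
def SolvesEL (a W u : ℝ → ℝ) : Prop :=
  ContDiff ℝ 1 u ∧
  ∀ s t : ℝ,
    deriv u t / Real.sqrt (1 - (deriv u t) ^ 2)
      - deriv u s / Real.sqrt (1 - (deriv u s) ^ 2)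
    = ∫ r in s..t, a r * deriv W (u r)

/-- The one-dimensional free-energy functional `J₁`. -/
def J1 (W u : ℝ → ℝ) : ℝ≥0∞ :=
  ∫⁻ t : ℝ, ENNReal.ofReal (1 - Real.sqrt (1 - (deriv u t) ^ 2) + W (u t))

theorem DoubleWell.continuous {W : ℝ → ℝ} (hW : DoubleWell W) : Continuous W :=
  hW.1.continuous

theorem DoubleWell.nonneg {W : ℝ → ℝ} (hW : DoubleWell W) (s : ℝ) : 0 ≤ W s := by
  obtain ⟨-, h1, h2, h3⟩ := hW
  by_cases hs : s = -1
  · rw [hs, h1]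
  by_cases hs' : s = 1
  · rw [hs', h2]
  exact (h3 s hs hs').le

/-- Stretching time by a factor `ψ ≥ 1` keeps a function in `X₁`, and its action is given by the
change of variables formula. -/
theorem exists_memX1_J1_eq_stretch (W : ℝ → ℝ) {u : ℝ → ℝ} (hu : memX1 u) {ψ : ℝ → ℝ} {C : ℝ}
    (hψm : Measurable ψ) (hψ1 : ∀ t, 1 ≤ ψ t) (hψC : ∀ t, ψ t ≤ C) :
    ∃ v, memX1 v ∧ J1 W v =
      ∫⁻ t : ℝ, ENNReal.ofReal (ψ t * (1 - Real.sqrt (1 - (deriv u t / ψ t) ^ 2) + W (u t))) := by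
  have hC1 : 1 ≤ C := (hψ1 0).trans (hψC 0)
  have hloc : LocallyIntegrable ψ volume := by
    refine (locallyIntegrable_const C).mono hψm.aestronglyMeasurable (ae_of_all _ fun t => ?_)
    rw [Real.norm_of_nonneg (by linarith [hψ1 t]), Real.norm_of_nonneg (by linarith)]
    exact hψC t
  have hint : ∀ a b, IntervalIntegrable ψ volume a b := fun a b =>
    intervalIntegrable_iff.2 <|
      (hloc.integrableOn_isCompact isCompact_uIcc).mono_set uIoc_subset_uIcc
  set Ψ : ℝ → ℝ := fun t => ∫ s in (0 : ℝ)..t, ψ s with hΨ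
  have hsub : ∀ a b, Ψ b - Ψ a = ∫ s in a..b, ψ s := fun a b =>
    intervalIntegral.integral_interval_sub_left (hint 0 b) (hint 0 a)
  have hlow : ∀ a b, a ≤ b → b - a ≤ Ψ b - Ψ a := fun a b hab => by
    rw [hsub]
    have := intervalIntegral.integral_mono_on hab intervalIntegrable_const (hint a b)
      (fun t _ => hψ1 t)
    simpa using this
  have hup : ∀ a b, a ≤ b → Ψ b - Ψ a ≤ C * (b - a) := fun a b hab => by
    rw [hsub]
    have := intervalIntegral.integral_mono_on hab (hint a b) intervalIntegrable_const
      (fun t _ => hψC t)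
    simpa [mul_comm] using this
  have hmono : StrictMono Ψ := fun a b hab => by linarith [hlow a b hab.le]
  have hlip : LipschitzWith C.toNNReal Ψ := by
    refine LipschitzWith.of_le_add_mul' C fun a b => ?_
    rw [Real.dist_eq]
    rcases le_total a b with h | h
    · have := hmono.monotone h
      nlinarith [abs_nonneg (a - b)]
    · rw [abs_of_nonneg (by linarith)]
      linarith [hup b a h]
  have hsurj : Function.Surjective Ψ := by
    have h0 : Ψ 0 = 0 := by simp [hΨ]
    refine hlip.continuous.surjective ?_ ?_
    · refine tendsto_atTop_mono' _ ?_ tendsto_id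
      filter_upwards [eventually_ge_atTop 0] with t ht
      have := hlow 0 t ht
      simp only [id]; linarith
    · refine tendsto_atBot_mono' _ ?_ tendsto_id
      filter_upwards [eventually_le_atBot 0] with t ht
      have := hlow t 0 ht
      simp only [id]; linarith
  let e : ℝ ≃o ℝ := hmono.orderIsoOfSurjective Ψ hsurj
  have heΨ : ∀ t, e.symm (Ψ t) = t := fun t => e.symm_apply_apply t
  have hΨe : ∀ t, Ψ (e.symm t) = t := fun t => e.apply_symm_apply t
  have helip : LipschitzWith 1 e.symm := by
    refine LipschitzWith.of_le_add fun a b => ?_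
    rw [Real.dist_eq]
    rcases le_total a b with h | h
    · have := e.symm.monotone h
      linarith [abs_nonneg (a - b)]
    · have := hlow _ _ (e.symm.monotone h)
      rw [hΨe, hΨe] at this
      linarith [le_abs_self (a - b)]
  refine ⟨u ∘ e.symm, ⟨by simpa using hu.1.comp helip, hu.2.1.comp e.symm.tendsto_atTop,
    hu.2.2.comp e.symm.tendsto_atBot⟩, ?_⟩
  have hae : ∀ᵐ t ∂(volume : Measure ℝ), HasDerivAt Ψ (ψ t) t ∧ DifferentiableAt ℝ u t := by
    filter_upwards [_root_.LocallyIntegrable.ae_hasDerivAt_integral hloc,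
      hu.1.ae_differentiableAt_real] with t h1 h2
    exact ⟨h1 0, h2⟩
  obtain ⟨s, hs, hsm, hsn⟩ : ∃ s : Set ℝ,
      (∀ t ∈ s, HasDerivAt Ψ (ψ t) t ∧ DifferentiableAt ℝ u t) ∧ MeasurableSet s ∧
        volume sᶜ = 0 := by
    obtain ⟨T, hT, hTm, hT0⟩ := exists_measurable_superset_of_null (ae_iff.1 hae)
    refine ⟨Tᶜ, fun t ht => ?_, hTm.compl, by simpa using hT0⟩
    by_contra h
    exact ht (hT h)
  have himg : volume (Ψ '' s)ᶜ = 0 := by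
    rw [← image_compl_eq ⟨hmono.injective, hsurj⟩]
    have := hlip.hausdorffMeasure_image_le zero_le_one sᶜ
    rw [hausdorffMeasure_real, hsn, mul_zero] at this
    exact le_antisymm this bot_le
  have hfull : ∀ {A : Set ℝ}, volume Aᶜ = 0 → ∀ g : ℝ → ℝ≥0∞,
      ∫⁻ t, g t = ∫⁻ t in A, g t := fun {A} hA g => by
    rw [Measure.restrict_eq_self_of_ae_mem (mem_ae_iff.2 hA)]
  rw [J1, hfull himg, lintegral_image_eq_lintegral_abs_deriv_mul hsm
    (fun t ht => (hs t ht).1.hasDerivWithinAt) hmono.injective.injOn, hfull hsn]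
  refine setLIntegral_congr_fun hsm fun t ht => ?_
  have hpos : 0 < ψ t := by linarith [hψ1 t]
  have hde : HasDerivAt e.symm (ψ t)⁻¹ (Ψ t) := by
    refine HasDerivAt.of_local_left_inverse helip.continuous.continuousAt ?_ hpos.ne'
      (Eventually.of_forall hΨe)
    rw [heΨ]
    exact (hs t ht).1
  have hdv : HasDerivAt (u ∘ e.symm) (deriv u t * (ψ t)⁻¹) (Ψ t) := by
    refine HasDerivAt.comp (Ψ t) ?_ hde
    rw [heΨ]
    exact (hs t ht).2.hasDerivAt
  simp only [hdv.deriv, Function.comp_apply, heΨ]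
  rw [abs_of_pos hpos, ENNReal.ofReal_mul hpos.le, div_eq_mul_inv]

/-- Clamping a function to `[-1, 1]` kills the action density wherever `|u| ≥ 1` and does not change
it elsewhere. -/
theorem density_clamp {W : ℝ → ℝ} (hW : DoubleWell W) {u : ℝ → ℝ} (hu : Continuous u) (t : ℝ) :
    1 - Real.sqrt (1 - (deriv (fun t => max (min 1 (u t)) (-1)) t) ^ 2)
      + W (max (min 1 (u t)) (-1)) =
    if |u t| < 1 then 1 - Real.sqrt (1 - (deriv u t) ^ 2) + W (u t) else 0 := by
  split_ifs with h
  · have hev : (fun t => max (min 1 (u t)) (-1)) =ᶠ[𝓝 t] u := by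
      filter_upwards [hu.abs.continuousAt.eventually_lt continuousAt_const h] with r hr
      rw [abs_lt] at hr
      rw [min_eq_right hr.2.le, max_eq_left hr.1.le]
    rw [hev.deriv_eq, hev.eq_of_nhds]
  · rw [not_lt, le_abs] at h
    rcases h with h | h
    · have h1 : max (min 1 (u t)) (-1) = 1 := by rw [min_eq_left h]; norm_num
      have hmax : IsLocalMax (fun t => max (min 1 (u t)) (-1)) t :=
        Eventually.of_forall fun r => by
          dsimp only
          rw [h1]
          exact max_le (min_le_left _ _) (by norm_num)
      rw [hmax.deriv_eq_zero, h1, hW.2.2.1]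
      norm_num
    · have h1 : max (min 1 (u t)) (-1) = -1 :=
        max_eq_right ((min_le_right _ _).trans (by linarith))
      have hmin : IsLocalMin (fun t => max (min 1 (u t)) (-1)) t :=
        Eventually.of_forall fun r => by
          dsimp only
          rw [h1]
          exact le_max_right _ _
      rw [hmin.deriv_eq_zero, h1, hW.2.1]
      norm_num

theorem memX1_clamp {u : ℝ → ℝ} (hu : memX1 u) : memX1 fun t => max (min 1 (u t)) (-1) := by
  refine ⟨(hu.1.const_min 1).max_const (-1), ?_, ?_⟩
  · simpa using ((tendsto_const_nhds (x := (1 : ℝ))).min hu.2.1).max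
      (tendsto_const_nhds (x := (-1 : ℝ)))
  · simpa using ((tendsto_const_nhds (x := (1 : ℝ))).min hu.2.2).max
      (tendsto_const_nhds (x := (-1 : ℝ)))

theorem DoubleWell.bddAbove_image {W : ℝ → ℝ} (hW : DoubleWell W) :
    BddAbove (W '' Icc (-1 : ℝ) 1) :=
  isCompact_Icc.bddAbove_image hW.continuous.continuousOn

/-- The clamped identity has finite action. -/
theorem exists_memX1_J1_ne_top {W : ℝ → ℝ} (hW : DoubleWell W) :
    ∃ v, memX1 v ∧ J1 W v ≠ ∞ := by
  refine ⟨fun t => max (min 1 t) (-1), ⟨(LipschitzWith.id.const_min 1).max_const (-1), ?_, ?_⟩, ?_⟩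
  · refine tendsto_const_nhds.congr' ?_
    filter_upwards [eventually_ge_atTop 1] with t ht
    rw [min_eq_left ht]; norm_num
  · refine tendsto_const_nhds.congr' ?_
    filter_upwards [eventually_le_atBot (-1)] with t ht
    rw [max_eq_right ((min_le_right _ _).trans ht)]
  · obtain ⟨M, hM⟩ := hW.bddAbove_image
    have hle : J1 W (fun t => max (min 1 t) (-1)) ≤
        ∫⁻ t, (Icc (-1 : ℝ) 1).indicator (fun _ => ENNReal.ofReal (1 + M)) t := by
      refine lintegral_mono fun t => ?_
      have hd := density_clamp hW continuous_id t
      simp only [id] at hd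
      dsimp only
      rw [hd]
      split_ifs with h
      · have ht : t ∈ Icc (-1 : ℝ) 1 := abs_le.1 h.le
        rw [indicator_of_mem ht]
        refine ENNReal.ofReal_le_ofReal ?_
        have := hM (mem_image_of_mem W ht)
        linarith [Real.sqrt_nonneg (1 - (deriv id t) ^ 2)]
      · simp
    refine (hle.trans_lt ?_).ne
    rw [lintegral_indicator measurableSet_Icc, setLIntegral_const]
    exact ENNReal.mul_lt_top ENNReal.ofReal_lt_top (by simp)

theorem measurable_density {W u : ℝ → ℝ} (hW : Continuous W) (hu : Continuous u) :
    Measurable fun t => ENNReal.ofReal (1 - Real.sqrt (1 - (deriv u t) ^ 2) + W (u t)) := by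
  have := measurable_deriv u
  have := (hW.comp hu).measurable
  simp only [Function.comp_def] at this
  fun_prop

theorem density_nonneg {W : ℝ → ℝ} (hW : DoubleWell W) (p s : ℝ) :
    0 ≤ 1 - Real.sqrt (1 - p ^ 2) + W s := by
  have : Real.sqrt (1 - p ^ 2) ≤ 1 := Real.sqrt_le_one.2 (by nlinarith [sq_nonneg p])
  linarith [hW.nonneg s]

/-- Minimizers take values in `[-1, 1]`. -/
theorem minimizer_ae_mem_Icc {W : ℝ → ℝ} (hW : DoubleWell W) {u : ℝ → ℝ}
    (hu : memX1 u) (hmin : ∀ v : ℝ → ℝ, memX1 v → J1 W u ≤ J1 W v) :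
    ∀ᵐ t ∂(volume : Measure ℝ), u t ∈ Icc (-1 : ℝ) 1 := by
  obtain ⟨v, hv, hvfin⟩ := exists_memX1_J1_ne_top hW
  have hcu := memX1_clamp hu
  have hle : ∀ t, 1 - Real.sqrt (1 - (deriv (fun t => max (min 1 (u t)) (-1)) t) ^ 2)
      + W (max (min 1 (u t)) (-1)) ≤ 1 - Real.sqrt (1 - (deriv u t) ^ 2) + W (u t) := fun t => by
    rw [density_clamp hW hu.1.continuous]
    split_ifs
    · exact le_rfl
    · exact density_nonneg hW _ _
  have hJ : J1 W (fun t => max (min 1 (u t)) (-1)) ≤ J1 W u :=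
    lintegral_mono fun t => ENNReal.ofReal_le_ofReal (hle t)
  have hae := ae_eq_of_ae_le_of_lintegral_le
    (ae_of_all volume fun t => ENNReal.ofReal_le_ofReal (hle t))
    (ne_top_of_le_ne_top hvfin (hJ.trans (hmin v hv)))
    (measurable_density hW.continuous hu.1.continuous).aemeasurable (hmin _ hcu)
  filter_upwards [hae] with t ht
  by_contra hmem
  rw [density_clamp hW hu.1.continuous, if_neg fun h => hmem (abs_le.1 h.le), ENNReal.ofReal_zero,
    eq_comm, ENNReal.ofReal_eq_zero] at ht
  have hpos : 0 < W (u t) := hW.2.2.2 _ (fun h => hmem (by rw [h]; norm_num))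
    (fun h => hmem (by rw [h]; norm_num))
  have : Real.sqrt (1 - (deriv u t) ^ 2) ≤ 1 :=
    Real.sqrt_le_one.2 (by nlinarith [sq_nonneg (deriv u t)])
  linarith

theorem mul_density_div {δ : ℝ} (hδ : 0 < 1 + δ) (p w : ℝ) :
    (1 + δ) * (1 - Real.sqrt (1 - (p / (1 + δ)) ^ 2) + w) =
      (1 + δ) * (1 + w) - Real.sqrt ((1 + δ) ^ 2 - p ^ 2) := by
  have : (1 + δ) ^ 2 - p ^ 2 = (1 + δ) ^ 2 * (1 - (p / (1 + δ)) ^ 2) := by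
    field_simp
  rw [this, Real.sqrt_mul (sq_nonneg _), Real.sqrt_sq hδ.le]
  ring

/-- If stretching by every factor `1 + 1 / (n + 1)` fails to decrease the action density, then the
slope satisfies the gradient bound. -/
theorem abs_le_of_forall_stretch {p w : ℝ} (hp : |p| ≤ 1) (hw : 0 ≤ w)
    (h : ∀ n : ℕ, Real.sqrt ((1 + 1 / ((n : ℝ) + 1)) ^ 2 - p ^ 2) ≤
      1 / ((n : ℝ) + 1) * (1 + w) + Real.sqrt (1 - p ^ 2)) :
    |p| ≤ Real.sqrt (1 - 1 / (1 + w) ^ 2) := by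
  by_contra! hlt
  have hp2 : p ^ 2 ≤ 1 := by rwa [sq_le_one_iff_abs_le_one]
  have h1 : 1 - 1 / (1 + w) ^ 2 < p ^ 2 := by
    have := Real.lt_sq_of_sqrt_lt hlt
    rwa [sq_abs] at this
  set q := Real.sqrt (1 - p ^ 2) with hq
  have hq0 : 0 ≤ q := Real.sqrt_nonneg _
  have hq2 : q ^ 2 = 1 - p ^ 2 := Real.sq_sqrt (by linarith)
  have hqw : (1 + w) * q < 1 := by
    have : (1 + w) ^ 2 * q ^ 2 < 1 := by
      have : q ^ 2 < 1 / (1 + w) ^ 2 := by linarith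
      rwa [lt_div_iff₀ (by positivity), mul_comm] at this
    have h2 : ((1 + w) * q) ^ 2 < 1 := by rwa [mul_pow]
    exact (sq_lt_one_iff₀ (by positivity)).1 h2
  obtain ⟨n, hn⟩ := exists_nat_one_div_lt
    (show 0 < 2 * (1 - (1 + w) * q) / (1 + w) ^ 2 from div_pos (by linarith) (by positivity))
  have hδ : 0 < 1 / ((n : ℝ) + 1) := by positivity
  specialize h n
  set δ := 1 / ((n : ℝ) + 1)
  rw [lt_div_iff₀ (by positivity)] at hn
  refine h.not_gt (Real.lt_sqrt_of_sq_lt ?_)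
  nlinarith [mul_lt_mul_of_pos_left hn hδ]

theorem minimizer_ae_gradient_bound {W : ℝ → ℝ} (hW : DoubleWell W) {u : ℝ → ℝ}
    (hu : memX1 u) (hmin : ∀ v : ℝ → ℝ, memX1 v → J1 W u ≤ J1 W v) :
    ∀ᵐ t ∂(volume : Measure ℝ), |deriv u t| ≤ Real.sqrt (1 - 1 / (1 + W (u t)) ^ 2) := by
  obtain ⟨v₀, hv₀, hv₀fin⟩ := exists_memX1_J1_ne_top hW
  have hfin : J1 W u ≠ ∞ := ne_top_of_le_ne_top hv₀fin (hmin v₀ hv₀)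
  have hdm : Measurable (deriv u) := measurable_deriv u
  have hWm : Measurable fun t => W (u t) := (hW.continuous.comp hu.1.continuous).measurable
  have key : ∀ n : ℕ, ∀ᵐ t ∂(volume : Measure ℝ),
      Real.sqrt ((1 + 1 / ((n : ℝ) + 1)) ^ 2 - deriv u t ^ 2) ≤
        1 / ((n : ℝ) + 1) * (1 + W (u t)) + Real.sqrt (1 - deriv u t ^ 2) := fun n => by
    have hδ : 0 < 1 / ((n : ℝ) + 1) := by positivity
    set δ := 1 / ((n : ℝ) + 1)
    set B : Set ℝ := {t | δ * (1 + W (u t)) + Real.sqrt (1 - deriv u t ^ 2) <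
      Real.sqrt ((1 + δ) ^ 2 - deriv u t ^ 2)} with hB
    have hBm : MeasurableSet B := by
      refine measurableSet_lt (.add (.const_mul (.const_add hWm 1) δ) ?_) ?_ <;> fun_prop
    classical
    set ψ : ℝ → ℝ := B.piecewise (fun _ => 1 + δ) (fun _ => 1)
    have hψB : ∀ t ∈ B, ψ t = 1 + δ := fun t ht => piecewise_eq_of_mem _ _ _ ht
    have hψB' : ∀ t ∉ B, ψ t = 1 := fun t ht => piecewise_eq_of_notMem _ _ _ ht
    obtain ⟨v, hv, hJv⟩ := exists_memX1_J1_eq_stretch W hu (ψ := ψ) (C := 1 + δ)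
      (Measurable.piecewise hBm measurable_const measurable_const)
      (fun t => by
        by_cases ht : t ∈ B
        · rw [hψB t ht]; linarith
        · rw [hψB' t ht])
      (fun t => by
        by_cases ht : t ∈ B
        · rw [hψB t ht]
        · rw [hψB' t ht]; linarith)
    have hlt : ∀ t ∈ B, ψ t * (1 - Real.sqrt (1 - (deriv u t / ψ t) ^ 2) + W (u t)) <
        1 - Real.sqrt (1 - (deriv u t) ^ 2) + W (u t) := fun t ht => by
      rw [hψB t ht, mul_density_div (by linarith)]
      rw [hB, mem_ofPred_eq] at ht
      linarith
    have hle : ∀ t, ψ t * (1 - Real.sqrt (1 - (deriv u t / ψ t) ^ 2) + W (u t)) ≤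
        1 - Real.sqrt (1 - (deriv u t) ^ 2) + W (u t) := fun t => by
      by_cases ht : t ∈ B
      · exact (hlt t ht).le
      · rw [hψB' t ht, div_one, one_mul]
    have hJ : J1 W v ≤ J1 W u := by
      rw [hJv]
      exact lintegral_mono fun t => ENNReal.ofReal_le_ofReal (hle t)
    have hae := ae_eq_of_ae_le_of_lintegral_le
      (ae_of_all volume fun t => ENNReal.ofReal_le_ofReal (hle t))
      (by rw [← hJv]; exact ne_top_of_le_ne_top hfin hJ)
      (measurable_density hW.continuous hu.1.continuous).aemeasurable
      (by rw [← hJv]; exact hmin v hv)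
    filter_upwards [hae] with t ht
    by_contra! hcon
    have hlt' := hlt t hcon
    have h0 : 0 ≤ ψ t * (1 - Real.sqrt (1 - (deriv u t / ψ t) ^ 2) + W (u t)) := by
      rw [hψB t hcon]
      exact mul_nonneg (by linarith) (density_nonneg hW _ _)
    exact ((ENNReal.ofReal_lt_ofReal_iff_of_nonneg h0).2 hlt').ne ht
  filter_upwards [ae_all_iff.2 key] with t ht
  refine abs_le_of_forall_stretch ?_ (hW.nonneg _) ht
  simpa using norm_deriv_le_of_lipschitz (x₀ := t) hu.1

/-- A minimizer of `J₁` over `X₁` satisfies the pointwise (a.e.) bound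
`|u'(t)| ≤ √(1 - 1/(1 + W(u(t)))²)`, hence the uniform bound
`‖u'‖_{L^∞} ≤ √(1 - 1/(1 + max_{[-1,1]} W)²) < 1`. -/
theorem J1_minimizer_gradient_bound (W : ℝ → ℝ) (hW : DoubleWell W) (u : ℝ → ℝ)
    (hu : memX1 u) (hmin : ∀ v : ℝ → ℝ, memX1 v → J1 W u ≤ J1 W v) :
    (∀ᵐ t ∂(volume : Measure ℝ),
      |deriv u t| ≤ Real.sqrt (1 - 1 / (1 + W (u t)) ^ 2)) ∧
    (∀ᵐ t ∂(volume : Measure ℝ),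
      |deriv u t| ≤ Real.sqrt (1 - 1 / (1 + sSup (W '' Set.Icc (-1 : ℝ) 1)) ^ 2)) ∧
    Real.sqrt (1 - 1 / (1 + sSup (W '' Set.Icc (-1 : ℝ) 1)) ^ 2) < 1 := by
  have hM0 : 0 ≤ sSup (W '' Icc (-1 : ℝ) 1) := by
    rw [← hW.2.2.1]
    exact le_csSup hW.bddAbove_image (mem_image_of_mem W (by norm_num))
  have hgrad := minimizer_ae_gradient_bound hW hu hmin
  refine ⟨hgrad, ?_, ?_⟩
  · filter_upwards [hgrad, minimizer_ae_mem_Icc hW hu hmin] with t ht hmem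
    have hle := le_csSup hW.bddAbove_image (mem_image_of_mem W hmem)
    have := hW.nonneg (u t)
    refine ht.trans (Real.sqrt_le_sqrt ?_)
    gcongr
  · rw [Real.sqrt_lt' one_pos]
    have : 0 < 1 / (1 + sSup (W '' Icc (-1 : ℝ) 1)) ^ 2 := by positivity
    linarith
end
end

section
/- Assume W ∈ C¹(ℝ) and a ∈ L^∞_loc(ℝ). If u_a ∈ X₁ is a minimizer of L_a over X₁, then u_a is a C¹ ∩ W^{2,2}_loc solution of (u'/√(1 − |u'|²))' = a(t) W'(u) on ℝ, and for every compact interval K ⊂ ℝ one has sup_{t ∈ K} |u_a'(t)| < 1. -/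
open MeasureTheory Filter Topology Set
open scoped ENNReal

noncomputable section

/-- The (real-valued) integrand of the action functional `L_a`. -/
def laIntegrand (a W u : ℝ → ℝ) (t : ℝ) : ℝ :=
  1 - Real.sqrt (1 - (deriv u t) ^ 2) + a t * W (u t)

/-- The function `y ↦ y / √(1 + y²)`, the inverse of `x ↦ x / √(1 - x²)`. -/
def bornInfeldInv (y : ℝ) : ℝ := y / √(1 + y ^ 2)

theorem one_add_sq_pos (y : ℝ) : 0 < 1 + y ^ 2 := by positivity

theorem continuous_bornInfeldInv : Continuous bornInfeldInv := by
  unfold bornInfeldInv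
  exact continuous_id.div (by fun_prop) fun y => (Real.sqrt_pos.2 (one_add_sq_pos y)).ne'

theorem one_sub_bornInfeldInv_sq (y : ℝ) : 1 - bornInfeldInv y ^ 2 = (1 / √(1 + y ^ 2)) ^ 2 := by
  have h := one_add_sq_pos y
  rw [bornInfeldInv, div_pow, div_pow, Real.sq_sqrt h.le]
  field_simp
  ring

theorem sqrt_one_sub_bornInfeldInv_sq (y : ℝ) :
    √(1 - bornInfeldInv y ^ 2) = 1 / √(1 + y ^ 2) := by
  rw [one_sub_bornInfeldInv_sq, Real.sqrt_sq (by positivity)]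

theorem abs_bornInfeldInv_lt_one (y : ℝ) : |bornInfeldInv y| < 1 := by
  rw [← sq_lt_one_iff_abs_lt_one]
  have h := one_sub_bornInfeldInv_sq y
  have := Real.sqrt_pos.2 (one_add_sq_pos y)
  have : 0 < (1 / √(1 + y ^ 2)) ^ 2 := by positivity
  linarith

theorem bornInfeldInv_div_sqrt (y : ℝ) :
    bornInfeldInv y / √(1 - bornInfeldInv y ^ 2) = y := by
  have := Real.sqrt_pos.2 (one_add_sq_pos y)
  rw [sqrt_one_sub_bornInfeldInv_sq, bornInfeldInv]
  field_simp

theorem bornInfeldInv_neg (y : ℝ) : bornInfeldInv (-y) = -bornInfeldInv y := by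
  simp [bornInfeldInv, neg_div]

theorem tendsto_bornInfeldInv_atTop : Tendsto bornInfeldInv atTop (𝓝 1) := by
  have h : Tendsto (fun y : ℝ => √(1 - (1 + y ^ 2)⁻¹)) atTop (𝓝 √(1 - 0)) := by
    refine (Real.continuous_sqrt.tendsto _).comp (tendsto_const_nhds.sub ?_)
    exact tendsto_inv_atTop_zero.comp
      (tendsto_atTop_add_const_left _ _ (tendsto_pow_atTop two_ne_zero))
  simp only [sub_zero, Real.sqrt_one] at h
  refine h.congr' ?_
  filter_upwards [eventually_ge_atTop 0] with y hy
  have := one_add_sq_pos y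
  rw [bornInfeldInv, show 1 - (1 + y ^ 2)⁻¹ = y ^ 2 / (1 + y ^ 2) by field_simp; ring,
    Real.sqrt_div (sq_nonneg y), Real.sqrt_sq hy]

theorem monotone_bornInfeldInv : Monotone bornInfeldInv := by
  refine monotone_of_deriv_nonneg ?_ ?_
  all_goals
    have key (y : ℝ) : HasDerivAt bornInfeldInv
        ((1 * √(1 + y ^ 2) - y * ((2 : ℕ) * y ^ (2 - 1) * 1 / (2 * √(1 + y ^ 2)))) / √(1 + y ^ 2) ^ 2)
          y := by
      refine (hasDerivAt_id' y).div ?_ (Real.sqrt_pos.2 (one_add_sq_pos y)).ne'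
      exact (((hasDerivAt_id' y).pow 2).const_add 1).sqrt (one_add_sq_pos y).ne'
  · exact fun y => (key y).differentiableAt
  · intro y
    rw [(key y).deriv]
    have := Real.sqrt_pos.2 (one_add_sq_pos y)
    have hs := Real.sq_sqrt (one_add_sq_pos y).le
    refine div_nonneg ?_ (by positivity)
    have : y * ((2 : ℕ) * y ^ (2 - 1) * 1 / (2 * √(1 + y ^ 2))) = y ^ 2 / √(1 + y ^ 2) := by
      norm_num
      field_simp
    rw [this, sub_nonneg, div_le_iff₀ (by assumption)]
    nlinarith

theorem sqrt_one_sub_sq_add_mul_le {x : ℝ} (hx : |x| ≤ 1) (y : ℝ) :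
    √(1 - x ^ 2) + y * x ≤ √(1 + y ^ 2) := by
  have h1 : 0 ≤ 1 - x ^ 2 := by have := (sq_le_one_iff_abs_le_one x).2 hx; linarith
  refine Real.le_sqrt_of_sq_le ?_
  nlinarith [Real.sq_sqrt h1, sq_nonneg (y * √(1 - x ^ 2) - x)]

theorem eq_bornInfeldInv_of_sqrt_one_sub_sq_add_mul_eq {x : ℝ} (hx : |x| ≤ 1) {y : ℝ}
    (h : √(1 - x ^ 2) + y * x = √(1 + y ^ 2)) : x = bornInfeldInv y := by
  have h1 : 0 ≤ 1 - x ^ 2 := by have := (sq_le_one_iff_abs_le_one x).2 hx; linarith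
  have hs := Real.sq_sqrt h1
  have hy := Real.sq_sqrt (one_add_sq_pos y).le
  have h0 : y * √(1 - x ^ 2) - x = 0 := by
    rw [← sq_eq_zero_iff]
    rw [← h] at hy
    nlinarith
  have hpos := Real.sqrt_pos.2 (one_add_sq_pos y)
  rw [bornInfeldInv, eq_div_iff hpos.ne', ← h]
  linear_combination (-√(1 - x ^ 2)) * h0 + y * hs

theorem concave_sqrt_one_sub_sq {x y l : ℝ} (hx : |x| ≤ 1) (hy : |y| ≤ 1) (h0 : 0 ≤ l)
    (h1 : l ≤ 1) :
    (1 - l) * √(1 - x ^ 2) + l * √(1 - y ^ 2) ≤ √(1 - ((1 - l) * x + l * y) ^ 2) := by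
  have hx' : 0 ≤ 1 - x ^ 2 := by have := (sq_le_one_iff_abs_le_one x).2 hx; linarith
  have hy' : 0 ≤ 1 - y ^ 2 := by have := (sq_le_one_iff_abs_le_one y).2 hy; linarith
  refine Real.le_sqrt_of_sq_le ?_
  have : √(1 - x ^ 2) * √(1 - y ^ 2) + x * y ≤ 1 := by
    nlinarith [Real.sq_sqrt hx', Real.sq_sqrt hy', sq_nonneg (√(1 - x ^ 2) - √(1 - y ^ 2)),
      sq_nonneg (x - y)]
  nlinarith [Real.sq_sqrt hx', Real.sq_sqrt hy', mul_nonneg h0 (sub_nonneg.2 h1)]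

/-- The Dirichlet problem for the relativistic operator is solvable for every admissible slope. -/
theorem exists_integral_bornInfeldInv_eq {A B d : ℝ} (hAB : A < B) (hd : |d| < B - A) {H : ℝ → ℝ}
    (hH : Continuous H) : ∃ c : ℝ, ∫ t in A..B, bornInfeldInv (c + H t) = d := by
  obtain ⟨M, hM⟩ := (isCompact_Icc (a := A) (b := B)).exists_bound_of_continuousOn hH.continuousOn
  obtain ⟨k, hk⟩ : ∃ k, |d| < bornInfeldInv k * (B - A) := by
    have := tendsto_bornInfeldInv_atTop.mul_const (B - A)
    rw [one_mul] at this
    exact (this.eventually (lt_mem_nhds hd)).exists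
  have hi (c : ℝ) : IntervalIntegrable (fun t => bornInfeldInv (c + H t)) volume A B :=
    (continuous_bornInfeldInv.comp (by fun_prop)).intervalIntegrable _ _
  have hcont : Continuous fun c => ∫ t in A..B, bornInfeldInv (c + H t) := by
    refine intervalIntegral.continuous_parametric_intervalIntegral_of_continuous' ?_ _ _
    exact continuous_bornInfeldInv.comp
      (continuous_fst.add (hH.comp continuous_snd) : Continuous fun p : ℝ × ℝ => p.1 + H p.2)
  have hup : d ≤ ∫ t in A..B, bornInfeldInv ((k + M) + H t) := by
    have := intervalIntegral.integral_mono_on hAB.le intervalIntegrable_const (hi (k + M))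
      (f := fun _ => bornInfeldInv k) fun t ht => monotone_bornInfeldInv (by
        have := hM t ht
        rw [Real.norm_eq_abs, abs_le] at this
        linarith)
    rw [intervalIntegral.integral_const, smul_eq_mul] at this
    linarith [le_abs_self d]
  have hlo : ∫ t in A..B, bornInfeldInv ((-(k + M)) + H t) ≤ d := by
    have := intervalIntegral.integral_mono_on hAB.le (hi (-(k + M))) intervalIntegrable_const
      (g := fun _ => bornInfeldInv (-k)) fun t ht => monotone_bornInfeldInv (by
        have := hM t ht
        rw [Real.norm_eq_abs, abs_le] at this
        linarith)
    rw [intervalIntegral.integral_const, smul_eq_mul, bornInfeldInv_neg] at this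
    linarith [neg_abs_le d]
  exact mem_range_of_exists_le_of_exists_ge hcont ⟨_, hlo⟩ ⟨_, hup⟩

theorem memX1.abs_deriv_le_one {u : ℝ → ℝ} (hu : memX1 u) (t : ℝ) : |deriv u t| ≤ 1 := by
  simpa using norm_deriv_le_of_lipschitz hu.1 (x₀ := t)

theorem memX1.convexComb {u w : ℝ → ℝ} (hu : memX1 u) (hw : memX1 w) {l : ℝ} (h0 : 0 ≤ l)
    (h1 : l ≤ 1) : memX1 fun t => u t + l * (w t - u t) := by
  refine ⟨LipschitzWith.of_dist_le_mul fun s t => ?_, ?_, ?_⟩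
  · have h2 := hu.1.dist_le_mul s t
    have h3 := hw.1.dist_le_mul s t
    simp only [NNReal.coe_one, one_mul, Real.dist_eq] at *
    calc |u s + l * (w s - u s) - (u t + l * (w t - u t))|
        = |(1 - l) * (u s - u t) + l * (w s - w t)| := by ring_nf
      _ ≤ |(1 - l) * (u s - u t)| + |l * (w s - w t)| := abs_add_le _ _
      _ = (1 - l) * |u s - u t| + l * |w s - w t| := by
        rw [abs_mul, abs_mul, abs_of_nonneg h0, abs_of_nonneg (sub_nonneg.2 h1)]
      _ ≤ |s - t| := by
        nlinarith [mul_nonneg h0 (sub_nonneg.2 h3),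
          mul_nonneg (sub_nonneg.2 h1) (sub_nonneg.2 h2)]
  · have h := hu.2.1.add ((hw.2.1.sub hu.2.1).const_mul l)
    rwa [sub_self, mul_zero, add_zero] at h
  · have h := hu.2.2.add ((hw.2.2.sub hu.2.2).const_mul l)
    rwa [sub_self, mul_zero, add_zero] at h

theorem exists_ae_abs_le_Icc {a : ℝ → ℝ}
    (haloc : ∀ R : ℝ, ∃ C : ℝ, ∀ᵐ t ∂(volume : Measure ℝ), |t| ≤ R → |a t| ≤ C) (A B : ℝ) :
    ∃ C : ℝ, 0 ≤ C ∧ ∀ᵐ t ∂(volume.restrict (Icc A B)), |a t| ≤ C := by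
  obtain ⟨C, hC⟩ := haloc (max |A| |B|)
  refine ⟨max C 0, le_max_right _ _, ?_⟩
  rw [ae_restrict_iff' measurableSet_Icc]
  filter_upwards [hC] with t ht hI
  exact (ht (abs_le_max_abs_abs hI.1 hI.2)).trans (le_max_left _ _)

theorem integrableOn_Icc_mul {a f : ℝ → ℝ} (hma : Measurable a)
    (haloc : ∀ R : ℝ, ∃ C : ℝ, ∀ᵐ t ∂(volume : Measure ℝ), |t| ≤ R → |a t| ≤ C)
    (hf : Continuous f) (A B : ℝ) : IntegrableOn (fun t => a t * f t) (Icc A B) := by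
  obtain ⟨C, -, hC⟩ := exists_ae_abs_le_Icc haloc A B
  have ha : IntegrableOn a (Icc A B) :=
    Measure.integrableOn_of_bounded (M := C) (by simp) hma.aestronglyMeasurable hC
  exact ha.mul_continuousOn hf.continuousOn isCompact_Icc

theorem integrableOn_Icc_sqrt_one_sub_deriv_sq (u : ℝ → ℝ) (A B : ℝ) :
    IntegrableOn (fun t => √(1 - deriv u t ^ 2)) (Icc A B) := by
  refine Measure.integrableOn_of_bounded (M := 1) (by simp)
    (Measurable.aestronglyMeasurable
      ((measurable_const.sub ((measurable_deriv u).pow_const 2)).sqrt)) (ae_of_all _ fun t => ?_)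
  rw [Real.norm_of_nonneg (Real.sqrt_nonneg _), Real.sqrt_le_iff]
  exact ⟨zero_le_one, by nlinarith [sq_nonneg (deriv u t)]⟩

/-- Differentiation under the integral sign of the potential term of the action. -/
theorem hasDerivAt_integral_mul_comp {W a u w : ℝ → ℝ} (hW : ContDiff ℝ 1 W) (hma : Measurable a)
    (haloc : ∀ R : ℝ, ∃ C : ℝ, ∀ᵐ t ∂(volume : Measure ℝ), |t| ≤ R → |a t| ≤ C)
    (hu : Continuous u) (hw : Continuous w) (A B : ℝ) :
    HasDerivAt (fun l : ℝ => ∫ t in Icc A B, a t * W (u t + l * (w t - u t)))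
      (∫ t in Icc A B, a t * deriv W (u t) * (w t - u t)) 0 := by
  obtain ⟨C, hC0, hC⟩ := exists_ae_abs_le_Icc haloc A B
  have hW' : Continuous (deriv W) := hW.continuous_deriv le_rfl
  have hcF : Continuous fun p : ℝ × ℝ =>
      deriv W (u p.2 + p.1 * (w p.2 - u p.2)) * (w p.2 - u p.2) := by fun_prop
  obtain ⟨M, hM⟩ := ((isCompact_Icc (a := (-1 : ℝ)) (b := 1)).prod
    (isCompact_Icc (a := A) (b := B))).exists_bound_of_continuousOn hcF.continuousOn
  have key := hasDerivAt_integral_of_dominated_loc_of_deriv_le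
    (μ := volume.restrict (Icc A B)) (x₀ := (0 : ℝ)) (s := Icc (-1) 1) (bound := fun _ => C * M)
    (F := fun l t => a t * W (u t + l * (w t - u t)))
    (F' := fun l t => a t * (deriv W (u t + l * (w t - u t)) * (w t - u t)))
    (Icc_mem_nhds (by norm_num) (by norm_num))
    (Eventually.of_forall fun l => Measurable.aestronglyMeasurable
      (hma.mul (hW.continuous.comp (by fun_prop)).measurable))
    (integrableOn_Icc_mul hma haloc (hW.continuous.comp (by fun_prop)) A B)
    (Measurable.aestronglyMeasurable
      (hma.mul (hcF.comp (by fun_prop : Continuous fun t : ℝ => ((0 : ℝ), t))).measurable))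
    (by
      filter_upwards [hC, ae_restrict_mem measurableSet_Icc] with t ht hI l hl
      rw [norm_mul]
      exact mul_le_mul ht (hM (l, t) ⟨hl, hI⟩) (norm_nonneg _) hC0)
    (integrable_const _)
    (ae_of_all _ fun t l _ => by
      have h1 : HasDerivAt (fun l : ℝ => u t + l * (w t - u t)) (w t - u t) l := by
        simpa using ((hasDerivAt_id' l).mul_const (w t - u t)).const_add (u t)
      exact (((hW.differentiable one_ne_zero) _).hasDerivAt.comp l h1).const_mul (a t))
  simpa [mul_assoc] using key.2

/-- The variational inequality satisfied by a minimizer, tested against a competitor which differs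
from it only on a compact interval. -/
theorem variational_inequality {W a u w : ℝ → ℝ} (hW : ContDiff ℝ 1 W) (hma : Measurable a)
    (haloc : ∀ R : ℝ, ∃ C : ℝ, ∀ᵐ t ∂(volume : Measure ℝ), |t| ≤ R → |a t| ≤ C)
    (hu : memX1 u) (hint : Integrable (laIntegrand a W u) volume)
    (hmin : ∀ v : ℝ → ℝ, memX1 v → Integrable (laIntegrand a W v) volume →
      ∫ t : ℝ, laIntegrand a W u t ≤ ∫ t : ℝ, laIntegrand a W v t)
    (hw : memX1 w) {A B : ℝ} (hout : ∀ t ∉ Icc A B, w t = u t) :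
    0 ≤ (∫ t in Icc A B, (√(1 - deriv u t ^ 2) - √(1 - deriv w t ^ 2))) +
      ∫ t in Icc A B, a t * deriv W (u t) * (w t - u t) := by
  have huc := hu.1.continuous
  have hwc := hw.1.continuous
  set D := ∫ t in Icc A B, (√(1 - deriv u t ^ 2) - √(1 - deriv w t ^ 2)) with hD
  let F : ℝ → ℝ := fun l => ∫ t in Icc A B, a t * W (u t + l * (w t - u t))
  have hFi (l : ℝ) : IntegrableOn (fun t => a t * W (u t + l * (w t - u t))) (Icc A B) :=
    integrableOn_Icc_mul hma haloc (hW.continuous.comp (by fun_prop)) A B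
  have hle : ∀ l ∈ Icc (0 : ℝ) 1, 0 ≤ l * D + (F l - F 0) := by
    rintro l ⟨h0, h1⟩
    set v : ℝ → ℝ := fun t => u t + l * (w t - u t) with hv
    have hvX : memX1 v := hu.convexComb hw h0 h1
    have hvu : ∀ t ∉ Icc A B, laIntegrand a W v t - laIntegrand a W u t = 0 := by
      intro t ht
      have he : v =ᶠ[𝓝 t] u := by
        filter_upwards [isClosed_Icc.isOpen_compl.mem_nhds ht] with s hs
        simp [hv, hout s hs]
      rw [laIntegrand, laIntegrand, he.deriv_eq, he.eq_of_nhds, sub_self]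
    have hdiff : IntegrableOn (fun t => laIntegrand a W v t - laIntegrand a W u t) (Icc A B) := by
      refine Integrable.sub ?_ hint.integrableOn
      exact ((integrable_const (1 : ℝ)).sub
        (integrableOn_Icc_sqrt_one_sub_deriv_sq v A B)).add (hFi l)
    have hdiff' : Integrable fun t => laIntegrand a W v t - laIntegrand a W u t := by
      rwa [integrableOn_iff_integrable_of_support_subset] at hdiff
      intro t ht
      by_contra h
      exact ht (hvu t h)
    have hvint : Integrable (laIntegrand a W v) := by
      refine (hdiff'.add hint).congr (ae_of_all _ fun t => ?_)
      simp
    have h2 := hmin v hvX hvint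
    rw [← sub_nonneg, ← integral_sub hvint hint,
      ← setIntegral_eq_integral_of_forall_compl_eq_zero hvu] at h2
    refine h2.trans ?_
    have hF0 : F 0 = ∫ t in Icc A B, a t * W (u t) := by simp [F]
    have hF0i : IntegrableOn (fun t => a t * W (u t)) (Icc A B) := by simpa using hFi 0
    have hsi : IntegrableOn (fun t => √(1 - deriv u t ^ 2) - √(1 - deriv w t ^ 2)) (Icc A B) :=
      (integrableOn_Icc_sqrt_one_sub_deriv_sq u A B).sub
        (integrableOn_Icc_sqrt_one_sub_deriv_sq w A B)
    have hPi : IntegrableOn (fun t => a t * W (u t + l * (w t - u t)) - a t * W (u t)) (Icc A B) :=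
      (hFi l).sub hF0i
    rw [hF0, ← integral_sub (hFi l) hF0i, hD, ← integral_const_mul,
      ← integral_add (hsi.const_mul l) hPi]
    refine integral_mono_ae hdiff ((hsi.const_mul l).add hPi) ?_
    filter_upwards [ae_restrict_of_ae hu.1.ae_differentiableAt_real,
      ae_restrict_of_ae hw.1.ae_differentiableAt_real] with t htu htw
    have hdv : deriv v t = (1 - l) * deriv u t + l * deriv w t := by
      have := htu.hasDerivAt.add ((htw.hasDerivAt.sub htu.hasDerivAt).const_mul l)
      have : HasDerivAt v _ t := this
      rw [this.deriv]
      ring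
    have hc := concave_sqrt_one_sub_sq (hu.abs_deriv_le_one t) (hw.abs_deriv_le_one t) h0 h1
    rw [← hdv] at hc
    simp only [laIntegrand]
    linarith
  have hder : HasDerivAt (fun l => l * D + (F l - F 0))
      (D + ∫ t in Icc A B, a t * deriv W (u t) * (w t - u t)) 0 := by
    have h := ((hasDerivAt_id' (0 : ℝ)).mul_const D).add
      ((hasDerivAt_integral_mul_comp hW hma haloc huc hwc A B).sub_const (F 0))
    rwa [one_mul] at h
  have ht := hder.tendsto_slope_zero_right
  refine ge_of_tendsto ht ?_
  filter_upwards [Ioc_mem_nhdsGT (zero_lt_one' ℝ)] with l hl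
  have := hle l ⟨hl.1.le, hl.2⟩
  have h3 := inv_pos.2 hl.1
  simp only [zero_add, zero_mul, sub_self, sub_zero, smul_eq_mul]
  positivity

theorem LipschitzWith.integral_deriv_eq_sub {u : ℝ → ℝ} {K : NNReal} (hu : LipschitzWith K u)
    (s t : ℝ) : ∫ r in s..t, deriv u r = u t - u s :=
  (hu.lipschitzOnWith.absolutelyContinuousOnInterval).integral_deriv_eq_sub

theorem memX1.intervalIntegrable_deriv {u : ℝ → ℝ} (hu : memX1 u) (s t : ℝ) :
    IntervalIntegrable (deriv u) volume s t :=
  (hu.1.lipschitzOnWith.absolutelyContinuousOnInterval).intervalIntegrable_deriv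

/-- Replacing the derivative of an element of `X₁` on a compact interval by a function bounded by
one and with the same mean value yields another element of `X₁`. -/
theorem memX1.exists_replace {u p : ℝ → ℝ} (hu : memX1 u) (hp : Continuous p)
    (hp1 : ∀ t, |p t| ≤ 1) {A B : ℝ} (hAB : A ≤ B) (hpi : ∫ t in A..B, p t = u B - u A) :
    ∃ w : ℝ → ℝ, memX1 w ∧ (∀ t ∉ Ioo A B, w t = u t) ∧
      ∀ t ∈ Icc A B, w t = u A + ∫ r in A..t, p r := by
  classical
  set g : ℝ → ℝ := (Ioc A B).piecewise p (deriv u) with hg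
  have hgm : Measurable g := hp.measurable.piecewise measurableSet_Ioc (measurable_deriv u)
  have hg1 (t : ℝ) : ‖g t‖ ≤ 1 := by
    by_cases h : t ∈ Ioc A B
    · simpa [hg, h] using hp1 t
    · simpa [hg, h] using hu.abs_deriv_le_one t
  have hgi (s t : ℝ) : IntervalIntegrable g volume s t :=
    (intervalIntegrable_const (c := (1 : ℝ))).mono_fun hgm.aestronglyMeasurable
      (ae_of_all _ fun t => by simpa using hg1 t)
  have hin : ∀ t ∈ Icc A B, ∫ r in A..t, g r = ∫ r in A..t, p r := by
    intro t ht
    refine intervalIntegral.integral_congr_ae (ae_of_all _ fun r hr => ?_)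
    rw [uIoc_of_le ht.1] at hr
    exact piecewise_eq_of_mem _ _ _ ⟨hr.1, hr.2.trans ht.2⟩
  have hout : ∀ t ∉ Ioo A B, u A + ∫ r in A..t, g r = u t := by
    intro t ht
    rcases le_or_gt t A with h | h
    · have : ∫ r in A..t, g r = ∫ r in A..t, deriv u r := by
        refine intervalIntegral.integral_congr_ae (ae_of_all _ fun r hr => ?_)
        rw [uIoc_of_ge h] at hr
        exact piecewise_eq_of_notMem _ _ _ fun h' => (hr.2.trans_lt h'.1).false
      rw [this, hu.1.integral_deriv_eq_sub]
      ring
    · have hB : B ≤ t := by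
        by_contra h'
        exact ht ⟨h, not_le.1 h'⟩
      have : ∫ r in B..t, g r = ∫ r in B..t, deriv u r := by
        refine intervalIntegral.integral_congr_ae (ae_of_all _ fun r hr => ?_)
        rw [uIoc_of_le hB] at hr
        exact piecewise_eq_of_notMem _ _ _ fun h' => (hr.1.trans_le h'.2).false
      rw [← intervalIntegral.integral_add_adjacent_intervals (hgi A B) (hgi B t), this,
        hu.1.integral_deriv_eq_sub, hin B ⟨hAB, le_rfl⟩, hpi]
      ring
  refine ⟨fun t => u A + ∫ r in A..t, g r, ⟨LipschitzWith.of_dist_le_mul fun s t => ?_, ?_, ?_⟩,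
    hout, fun t ht => congrArg (u A + ·) (hin t ht)⟩
  · rw [dist_add_left, Real.dist_eq, intervalIntegral.integral_interval_sub_left (hgi _ _) (hgi _ _),
      NNReal.coe_one, Real.dist_eq]
    exact intervalIntegral.norm_integral_le_of_norm_le_const fun r _ => hg1 r
  · refine hu.2.1.congr' ?_
    filter_upwards [eventually_ge_atTop B] with t ht
    exact (hout t fun h => (h.2.trans_le ht).false).symm
  · refine hu.2.2.congr' ?_
    filter_upwards [eventually_le_atBot A] with t ht
    exact (hout t fun h => (h.1.trans_le ht).false).symm

theorem hasDerivAt_of_eq_add_integral {u p : ℝ → ℝ} (hp : Continuous p) {A B k : ℝ}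
    (h : ∀ t ∈ Icc A B, u t = k + ∫ r in A..t, p r) {t : ℝ} (ht : t ∈ Ioo A B) :
    HasDerivAt u (p t) t := by
  refine ((hp.integral_hasStrictDerivAt A t).hasDerivAt.const_add k).congr_of_eventuallyEq ?_
  filter_upwards [Ioo_mem_nhds ht.1 ht.2] with s hs
  exact h s (Ioo_subset_Icc_self hs)

/-- On every interval on which a minimizer has mean slope less than one in absolute value, it solves
the Euler-Lagrange equation in integrated form. -/
theorem exists_hasDerivAt_of_minimizer {W a u : ℝ → ℝ} (hW : ContDiff ℝ 1 W) (hma : Measurable a)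
    (haloc : ∀ R : ℝ, ∃ C : ℝ, ∀ᵐ t ∂(volume : Measure ℝ), |t| ≤ R → |a t| ≤ C)
    (hu : memX1 u) (hint : Integrable (laIntegrand a W u) volume)
    (hmin : ∀ v : ℝ → ℝ, memX1 v → Integrable (laIntegrand a W v) volume →
      ∫ t : ℝ, laIntegrand a W u t ≤ ∫ t : ℝ, laIntegrand a W v t)
    (hh : ∀ s t : ℝ, IntervalIntegrable (fun r => a r * deriv W (u r)) volume s t)
    {A B : ℝ} (hAB : A < B) (hslope : |u B - u A| < B - A) :
    ∃ c : ℝ, ∀ t ∈ Ioo A B,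
      HasDerivAt u (bornInfeldInv (c + ∫ r in A..t, a r * deriv W (u r))) t := by
  have hH : Continuous fun t => ∫ r in A..t, a r * deriv W (u r) :=
    intervalIntegral.continuous_primitive hh A
  obtain ⟨c, hc⟩ := exists_integral_bornInfeldInv_eq hAB hslope hH
  refine ⟨c, ?_⟩
  set Y : ℝ → ℝ := fun t => c + ∫ r in A..t, a r * deriv W (u r) with hY
  have hYc : Continuous Y := continuous_const.add hH
  have hpc : Continuous fun t => bornInfeldInv (Y t) := continuous_bornInfeldInv.comp hYc
  obtain ⟨w, hwX, hwout, hwin⟩ := hu.exists_replace hpc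
    (fun t => (abs_bornInfeldInv_lt_one (Y t)).le) hAB.le hc
  have hwd : ∀ t ∈ Ioo A B, HasDerivAt w (bornInfeldInv (Y t)) t := fun t ht =>
    hasDerivAt_of_eq_add_integral hpc hwin ht
  have hvar := variational_inequality hW hma haloc hu hint hmin hwX (A := A) (B := B)
    fun t ht => hwout t fun h => ht (Ioo_subset_Icc_self h)
  have hYac : AbsolutelyContinuousOnInterval Y A B := by
    have := (hh A B).absolutelyContinuousOnInterval_intervalIntegral (c := A) (by simp)
    exact (LipschitzWith.const c).lipschitzOnWith.absolutelyContinuousOnInterval.add this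
  have hηac : AbsolutelyContinuousOnInterval (w - u) A B :=
    hwX.1.lipschitzOnWith.absolutelyContinuousOnInterval.sub
      hu.1.lipschitzOnWith.absolutelyContinuousOnInterval
  have hparts := hYac.integral_mul_deriv_eq_deriv_mul hηac
  rw [Pi.sub_apply, Pi.sub_apply, hwout A (by simp), hwout B (by simp), sub_self, sub_self,
    mul_zero, mul_zero, sub_zero, zero_sub, intervalIntegral.integral_of_le hAB.le,
    intervalIntegral.integral_of_le hAB.le, ← integral_Icc_eq_integral_Ioc,
    ← integral_Icc_eq_integral_Ioc] at hparts
  have hIoo : ∀ᵐ t ∂(volume.restrict (Icc A B)), t ∈ Ioo A B := by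
    rw [← restrict_Ioo_eq_restrict_Icc]
    exact ae_restrict_mem measurableSet_Ioo
  have hYderiv : ∫ t in Icc A B, deriv Y t * (w - u) t
      = ∫ t in Icc A B, a t * deriv W (u t) * (w t - u t) := by
    refine integral_congr_ae ?_
    have := (hh A B).ae_hasDerivAt_integral
    filter_upwards [ae_restrict_of_ae this, hIoo] with t ht hI
    have hd : HasDerivAt Y _ t :=
      (ht (by rw [uIcc_of_le hAB.le]; exact Ioo_subset_Icc_self hI) A (by simp)).const_add c
    rw [hd.deriv, Pi.sub_apply]
  have hduI : IntegrableOn (deriv u) (Icc A B) :=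
    (intervalIntegrable_iff_integrableOn_Icc_of_le hAB.le).1 (hu.intervalIntegrable_deriv A B)
  have hui := integrableOn_Icc_sqrt_one_sub_deriv_sq u A B
  have hwi := integrableOn_Icc_sqrt_one_sub_deriv_sq w A B
  have hYη : IntegrableOn (fun t => Y t * deriv (w - u) t) (Icc A B) :=
    (intervalIntegrable_iff_integrableOn_Icc_of_le hAB.le).1
      (hηac.intervalIntegrable_deriv.continuousOn_mul hYc.continuousOn)
  set E : ℝ → ℝ := fun t => √(1 + Y t ^ 2) - (√(1 - deriv u t ^ 2) + Y t * deriv u t) with hE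
  have hE0 : 0 ≤ E := fun t =>
    sub_nonneg.2 (sqrt_one_sub_sq_add_mul_le (hu.abs_deriv_le_one t) (Y t))
  have hdu : ∀ᵐ t ∂(volume.restrict (Icc A B)), DifferentiableAt ℝ u t :=
    ae_restrict_of_ae hu.1.ae_differentiableAt_real
  have hEeq : E =ᵐ[volume.restrict (Icc A B)] fun t =>
      Y t * deriv (w - u) t - (√(1 - deriv u t ^ 2) - √(1 - deriv w t ^ 2)) := by
    filter_upwards [hIoo, hdu] with t hI ht
    rw [((hwd t hI).sub ht.hasDerivAt).deriv, (hwd t hI).deriv, sqrt_one_sub_bornInfeldInv_sq]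
    have hpos := Real.sqrt_pos.2 (one_add_sq_pos (Y t))
    have hs := Real.sq_sqrt (one_add_sq_pos (Y t)).le
    have : √(1 + Y t ^ 2) = Y t * bornInfeldInv (Y t) + 1 / √(1 + Y t ^ 2) := by
      rw [bornInfeldInv]
      field_simp
      linarith
    simp only [hE]
    linarith
  have huwi : IntegrableOn (fun t => √(1 - deriv u t ^ 2) - √(1 - deriv w t ^ 2)) (Icc A B) :=
    hui.sub hwi
  have hEint : IntegrableOn E (Icc A B) := (hYη.sub huwi).congr hEeq.symm
  have hEle : ∫ t in Icc A B, E t ≤ 0 := by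
    rw [integral_congr_ae hEeq, integral_sub hYη huwi, hparts, hYderiv]
    linarith
  have hEz : E =ᵐ[volume.restrict (Icc A B)] 0 :=
    (integral_eq_zero_iff_of_nonneg hE0 hEint).1
      (le_antisymm hEle (integral_nonneg hE0))
  have hup : ∀ᵐ t ∂(volume.restrict (Icc A B)), deriv u t = bornInfeldInv (Y t) := by
    filter_upwards [hEz] with t ht
    exact eq_bornInfeldInv_of_sqrt_one_sub_sq_add_mul_eq (hu.abs_deriv_le_one t)
      (sub_eq_zero.1 ht).symm
  rw [ae_restrict_iff' measurableSet_Icc] at hup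
  refine fun t ht => hasDerivAt_of_eq_add_integral (k := u A) hpc (fun s hs => ?_) ht
  have : ∫ r in A..s, bornInfeldInv (Y r) = ∫ r in A..s, deriv u r := by
    refine intervalIntegral.integral_congr_ae ?_
    filter_upwards [hup] with r hr hI
    rw [uIoc_of_le hs.1] at hI
    exact (hr ⟨hI.1.le, hI.2.trans hs.2⟩).symm
  rw [this, hu.1.integral_deriv_eq_sub]
  ring

theorem memX1.exists_abs_sub_lt {u : ℝ → ℝ} (hu : memX1 u) :
    ∃ R₀ : ℝ, ∀ R ≥ R₀, -R < R ∧ |u R - u (-R)| < R - (-R) := by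
  have h1 := hu.2.1.sub (hu.2.2.comp tendsto_neg_atTop_atBot)
  have h2 := h1.abs.eventually (gt_mem_nhds (show |(1 : ℝ) - -1| < 4 by norm_num))
  obtain ⟨R₀, hR₀⟩ := eventually_atTop.1 (h2.and (eventually_ge_atTop 2))
  refine ⟨R₀, fun R hR => ?_⟩
  have h3 := (hR₀ R hR).1
  simp only [Function.comp_apply] at h3
  have h4 := (hR₀ R hR).2
  constructor <;> linarith

/-- Under `(W₁)` and `(a₁')`, any minimizer `u_a ∈ X₁` of `L_a` is a
`C¹ ∩ W^{2,2}_loc` solution of `(u'/√(1-|u'|²))' = a(t)W'(u)` and `sup_K |u_a'| < 1` on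
every compact `K ⊂ ℝ`. -/
theorem minimizer_is_local_solution (W a : ℝ → ℝ)
    (hW : ContDiff ℝ 1 W) (hma : Measurable a)
    (haloc : ∀ R : ℝ, ∃ C : ℝ, ∀ᵐ t ∂(volume : Measure ℝ), |t| ≤ R → |a t| ≤ C)
    (u : ℝ → ℝ) (hu : memX1 u)
    (hint : Integrable (laIntegrand a W u) volume)
    (hmin : ∀ v : ℝ → ℝ, memX1 v → Integrable (laIntegrand a W v) volume →
      ∫ t : ℝ, laIntegrand a W u t ≤ ∫ t : ℝ, laIntegrand a W v t) :
    SolvesEL a W u ∧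
    ∀ K : Set ℝ, IsCompact K → ∃ c : ℝ, c < 1 ∧ ∀ t ∈ K, |deriv u t| ≤ c := by
  have hW' : Continuous (deriv W) := hW.continuous_deriv le_rfl
  have hh (s t : ℝ) : IntervalIntegrable (fun r => a r * deriv W (u r)) volume s t :=
    IntegrableOn.intervalIntegrable
      (integrableOn_Icc_mul hma haloc (hW'.comp hu.1.continuous) (s ⊓ t) (s ⊔ t))
  obtain ⟨R₀, hR₀⟩ := hu.exists_abs_sub_lt
  have key (s t : ℝ) : ∃ A B c : ℝ, s ∈ Ioo A B ∧ t ∈ Ioo A B ∧ ∀ r ∈ Ioo A B,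
      HasDerivAt u (bornInfeldInv (c + ∫ x in A..r, a x * deriv W (u x))) r := by
    have hR := hR₀ (max R₀ (|s| + |t| + 1)) (le_max_left _ _)
    set R := max R₀ (|s| + |t| + 1)
    have hle : |s| + |t| + 1 ≤ R := le_max_right _ _
    obtain ⟨c, hc⟩ := exists_hasDerivAt_of_minimizer hW hma haloc hu hint hmin hh hR.1 hR.2
    refine ⟨-R, R, c, abs_lt.1 ?_, abs_lt.1 ?_, hc⟩ <;> linarith [abs_nonneg s, abs_nonneg t]
  have hlt (t : ℝ) : |deriv u t| < 1 := by
    obtain ⟨A, B, c, -, ht, hd⟩ := key t t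
    rw [(hd t ht).deriv]
    exact abs_bornInfeldInv_lt_one _
  have hcont : Continuous (deriv u) := by
    refine continuous_iff_continuousAt.2 fun t => ?_
    obtain ⟨A, B, c, -, ht, hd⟩ := key t t
    have : Continuous fun r => bornInfeldInv (c + ∫ x in A..r, a x * deriv W (u x)) :=
      continuous_bornInfeldInv.comp
        (continuous_const.add (intervalIntegral.continuous_primitive hh A))
    refine this.continuousAt.congr ?_
    filter_upwards [Ioo_mem_nhds ht.1 ht.2] with r hr
    exact (hd r hr).deriv.symm
  refine ⟨⟨contDiff_one_iff_deriv.2 ⟨fun t => ?_, hcont⟩, fun s t => ?_⟩, fun K hK => ?_⟩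
  · obtain ⟨A, B, c, -, ht, hd⟩ := key t t
    exact (hd t ht).differentiableAt
  · obtain ⟨A, B, c, hs, ht, hd⟩ := key s t
    rw [(hd s hs).deriv, (hd t ht).deriv, bornInfeldInv_div_sqrt, bornInfeldInv_div_sqrt,
      add_sub_add_left_eq_sub, intervalIntegral.integral_interval_sub_left (hh _ _) (hh _ _)]
  · rcases K.eq_empty_or_nonempty with rfl | hne
    · exact ⟨0, one_pos, by simp⟩
    · obtain ⟨x, -, hx⟩ := hK.exists_isMaxOn hne hcont.abs.continuousOn
      exact ⟨|deriv u x|, hlt x, fun t ht => hx ht⟩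
end
end

section
/- Let W(s) = −1 + √(2 / (2 − (1 − s²)²)) for s ∈ [−1,1]. Then for every a ∈ ℝ, the function u(t) = tanh((t + a)/√2) satisfies |u'(t)| < 1 for all t, solves the equation (u'/√(1 − |u'|²))' = W'(u) on ℝ, satisfies lim_{t→±∞}(u(t), u'(t)) = (±1, 0), and satisfies the energy identity −|u'(t)|²/2 + (u(t)² − 1)²/4 = 0 for all t ∈ ℝ. -/
open MeasureTheory Filter Topology Set
open scoped ENNReal

noncomputable section

/-- The explicit potential `W(s) = -1 + √(2 / (2 - (1 - s²)²))`. -/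
def Wex (s : ℝ) : ℝ := -1 + Real.sqrt (2 / (2 - (1 - s ^ 2) ^ 2))

/-- The explicit heteroclinic `u(t) = tanh((t + a)/√2)`. -/
def uex (a t : ℝ) : ℝ := Real.tanh ((t + a) / Real.sqrt 2)

theorem Real.hasDerivAt_tanh_one_sub_sq (x : ℝ) :
    HasDerivAt Real.tanh (1 - Real.tanh x ^ 2) x := by
  have hc : Real.cosh x ≠ 0 := (Real.cosh_pos x).ne'
  have h := (Real.hasDerivAt_sinh x).fun_div (Real.hasDerivAt_cosh x) hc
  simp only [← Real.tanh_eq_sinh_div_cosh] at h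
  refine h.congr_deriv ?_
  rw [Real.tanh_eq_sinh_div_cosh]
  field_simp

theorem Real.tanh_eq_one_sub_two_div (x : ℝ) :
    Real.tanh x = 1 - 2 / (Real.exp (2 * x) + 1) := by
  have h : Real.exp (2 * x) = Real.exp x ^ 2 := by rw [two_mul, Real.exp_add, sq]
  have hx := Real.exp_pos x
  rw [Real.tanh_eq, h, Real.exp_neg]
  field_simp
  ring

theorem Real.tendsto_tanh_atTop_nhds_one : Tendsto Real.tanh atTop (𝓝 1) := by
  have h : Tendsto (fun x : ℝ => Real.exp (2 * x) + 1) atTop atTop :=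
    tendsto_atTop_add_const_right _ _
      (Real.tendsto_exp_atTop.comp (tendsto_id.const_mul_atTop two_pos))
  simpa [funext Real.tanh_eq_one_sub_two_div] using (h.const_div_atTop 2).const_sub 1

theorem Real.tendsto_tanh_atBot_nhds_neg_one : Tendsto Real.tanh atBot (𝓝 (-1)) := by
  have h := (Real.tendsto_tanh_atTop_nhds_one.comp tendsto_neg_atBot_atTop).neg
  simpa [Function.comp_def] using h

theorem hasDerivAt_uex (a t : ℝ) :
    HasDerivAt (uex a) ((1 - uex a t ^ 2) / Real.sqrt 2) t := by
  have h := (Real.hasDerivAt_tanh_one_sub_sq ((t + a) / Real.sqrt 2)).comp t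
    (((hasDerivAt_id t).add_const a).div_const (Real.sqrt 2))
  exact h.congr_deriv (mul_one_div _ _)

theorem deriv_uex (a : ℝ) : deriv (uex a) = fun t => (1 - uex a t ^ 2) / Real.sqrt 2 :=
  funext fun t => (hasDerivAt_uex a t).deriv

theorem Wex_eq_inv_sqrt (s : ℝ) :
    Wex s = -1 + (Real.sqrt (1 - ((1 - s ^ 2) / Real.sqrt 2) ^ 2))⁻¹ := by
  rw [Wex, ← Real.sqrt_inv, div_pow, Real.sq_sqrt zero_le_two, one_sub_div two_ne_zero, inv_div]

theorem HasDerivAt.sqrt_one_sub_sq {f : ℝ → ℝ} {f' x : ℝ} (hf : HasDerivAt f f' x)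
    (h : f x ^ 2 < 1) :
    HasDerivAt (fun y => Real.sqrt (1 - f y ^ 2)) (-(f x * f') / Real.sqrt (1 - f x ^ 2)) x := by
  refine (((hf.fun_pow 2).const_sub 1).sqrt (sub_pos.2 h).ne').congr_deriv ?_
  have := Real.sqrt_pos.2 (sub_pos.2 h)
  field_simp
  norm_num
  ring

theorem hasDerivAt_inv_sqrt_one_sub_sq {f : ℝ → ℝ} {f' x : ℝ} (hf : HasDerivAt f f' x)
    (h : f x ^ 2 < 1) :
    HasDerivAt (fun y => (Real.sqrt (1 - f y ^ 2))⁻¹)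
      (f x * f' / Real.sqrt (1 - f x ^ 2) ^ 3) x := by
  have hpos := Real.sqrt_pos.2 (sub_pos.2 h)
  refine ((hf.sqrt_one_sub_sq h).fun_inv hpos.ne').congr_deriv ?_
  field_simp

theorem hasDerivAt_div_sqrt_one_sub_sq {f : ℝ → ℝ} {f' x : ℝ} (hf : HasDerivAt f f' x)
    (h : f x ^ 2 < 1) :
    HasDerivAt (fun y => f y / Real.sqrt (1 - f y ^ 2))
      (f' / Real.sqrt (1 - f x ^ 2) ^ 3) x := by
  have hpos := Real.sqrt_pos.2 (sub_pos.2 h)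
  have hsq := Real.sq_sqrt (sub_pos.2 h).le
  refine (hf.fun_div (hf.sqrt_one_sub_sq h) hpos.ne').congr_deriv ?_
  field_simp
  rw [hsq]
  ring

theorem sq_deriv_uex_lt_one (a t : ℝ) : ((1 - uex a t ^ 2) / Real.sqrt 2) ^ 2 < 1 := by
  have h : uex a t ^ 2 < 1 := Real.tanh_sq_lt_one _
  rw [div_pow, Real.sq_sqrt zero_le_two, div_lt_one two_pos]
  nlinarith [sq_nonneg (uex a t)]

theorem hasDerivAt_one_sub_sq_div_sqrt_two (s : ℝ) :
    HasDerivAt (fun s : ℝ => (1 - s ^ 2) / Real.sqrt 2) (-(2 * s) / Real.sqrt 2) s := by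
  simpa using ((hasDerivAt_pow 2 s).const_sub 1).div_const (Real.sqrt 2)

theorem tendsto_add_div_sqrt_two_atTop (a : ℝ) :
    Tendsto (fun t : ℝ => (t + a) / Real.sqrt 2) atTop atTop :=
  (tendsto_atTop_add_const_right _ a tendsto_id).atTop_div_const (by positivity)

theorem tendsto_add_div_sqrt_two_atBot (a : ℝ) :
    Tendsto (fun t : ℝ => (t + a) / Real.sqrt 2) atBot atBot :=
  (tendsto_atBot_add_const_right _ a tendsto_id).atBot_div_const (by positivity)

/-- For `W(s) = -1 + √(2/(2 - (1 - s²)²))`, every translate of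
`tanh(t/√2)` is a timelike heteroclinic solution of `(u'/√(1-|u'|²))' = W'(u)` with
`(u,u') → (±1,0)` at `±∞`, satisfying the Allen–Cahn energy identity
`-|u'|²/2 + (u² - 1)²/4 = 0`. -/
theorem explicit_heteroclinic (a : ℝ) :
    (∀ t : ℝ, |deriv (uex a) t| < 1) ∧
    (∀ t : ℝ, HasDerivAt
      (fun s : ℝ => deriv (uex a) s / Real.sqrt (1 - (deriv (uex a) s) ^ 2))
      (deriv Wex (uex a t)) t) ∧
    Tendsto (uex a) atTop (𝓝 (1:ℝ)) ∧ Tendsto (uex a) atBot (𝓝 (-1:ℝ)) ∧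
    Tendsto (deriv (uex a)) atTop (𝓝 (0:ℝ)) ∧ Tendsto (deriv (uex a)) atBot (𝓝 (0:ℝ)) ∧
    (∀ t : ℝ, -(deriv (uex a) t) ^ 2 / 2 + ((uex a t) ^ 2 - 1) ^ 2 / 4 = 0) := by
  have htop : Tendsto (uex a) atTop (𝓝 1) :=
    Real.tendsto_tanh_atTop_nhds_one.comp (tendsto_add_div_sqrt_two_atTop a)
  have hbot : Tendsto (uex a) atBot (𝓝 (-1)) :=
    Real.tendsto_tanh_atBot_nhds_neg_one.comp (tendsto_add_div_sqrt_two_atBot a)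
  simp only [deriv_uex]
  refine ⟨fun t => (sq_lt_one_iff_abs_lt_one _).1 (sq_deriv_uex_lt_one a t), fun t => ?_,
    htop, hbot, ?_, ?_, fun t => ?_⟩
  · have hq := hasDerivAt_one_sub_sq_div_sqrt_two (uex a t)
    have hlt := sq_deriv_uex_lt_one a t
    have hW := (hasDerivAt_inv_sqrt_one_sub_sq hq hlt).const_add (-1)
    simp only [← Wex_eq_inv_sqrt] at hW
    rw [hW.deriv]
    refine (hasDerivAt_div_sqrt_one_sub_sq (hq.comp t (hasDerivAt_uex a t)) hlt).congr_deriv ?_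
    rw [mul_comm]
    rfl
  · simpa using ((htop.pow 2).const_sub 1).div_const (Real.sqrt 2)
  · simpa using ((hbot.pow 2).const_sub 1).div_const (Real.sqrt 2)
  · rw [div_pow, Real.sq_sqrt zero_le_two]
    ring
end
end
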